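/- arXiv:gr-qc/9510068 — 8 statements merged into one kernel-verified Lean document; each statement's English description precedes it below -/
import Mathlib

section
/- Let f : ℝ → ℝ be continuous and nonnegative, and suppose there exist constants C > 0 and δ > 0 such that f(u) ≤ C·(1+|u|)^(−4−δ) for all u ∈ ℝ. Define F(c) = ∫₀^∞ f(−x + c·x²)·x² dx. Then F(c) is finite for every c ≤ 0, and F(c) tends to the finite value F(0) as c tends to 0 from the left. -/
open MeasureTheory Set Filter
open scoped ENNReal

/-- A function decaying like `(1+|u|)^(-4-δ)`, composed with `x ↦ -x + c x²` for `c ≤ 0` and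
weighted by `x²`, is dominated on `(0,∞)` by a multiple of `(1+|x|)^(-(2+δ))`. -/
theorem mul_sq_le_of_decay {f : ℝ → ℝ} {C δ : ℝ} (hC : 0 < C) (hδ : 0 < δ)
    (h : ∀ u : ℝ, f u ≤ C * (1 + |u|) ^ (-4 - δ)) {c x : ℝ} (hc : c ≤ 0) (hx : 0 < x) :
    f (-x + c * x ^ 2) * x ^ 2 ≤ C * (1 + ‖x‖) ^ (-(2 + δ)) := by
  have hcx : c * x ^ 2 ≤ 0 := mul_nonpos_of_nonpos_of_nonneg hc (sq_nonneg x)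
  have habs : x ≤ |-x + c * x ^ 2| := by
    rw [abs_of_nonpos (by linarith)]
    linarith
  have hpow : (1 + |-x + c * x ^ 2|) ^ (-4 - δ) ≤ (1 + x) ^ (-4 - δ) :=
    Real.rpow_le_rpow_of_nonpos (by linarith) (by linarith) (by linarith)
  have hpos : 0 < 1 + x := by linarith
  calc f (-x + c * x ^ 2) * x ^ 2
      ≤ (C * (1 + x) ^ (-4 - δ)) * (1 + x) ^ 2 := by
        have hf := (h (-x + c * x ^ 2)).trans (mul_le_mul_of_nonneg_left hpow hC.le)
        have hsq : x ^ 2 ≤ (1 + x) ^ 2 := by gcongr; linarith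
        exact mul_le_mul hf hsq (by positivity) (by positivity)
    _ = C * (1 + ‖x‖) ^ (-(2 + δ)) := by
        rw [Real.norm_of_nonneg hx.le, mul_assoc, ← Real.rpow_natCast (1 + x) 2,
          ← Real.rpow_add hpos]
        congr 2
        push_cast
        ring

/-- Lemma 1 of the paper (finite left limit part): if `f : ℝ → ℝ` is continuous,
nonnegative and decays like `(1+|u|)^(-4-δ)`, then
`F c = ∫⁻ x in (0,∞), f (-x + c x²) · x² dx` is finite for every `c ≤ 0`,
and `F c → F 0` as `c → 0⁻`. -/
theorem stmt_0 (f : ℝ → ℝ) (hf_cont : Continuous f) (hf_nonneg : ∀ u, 0 ≤ f u)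
    (hdecay : ∃ C > (0:ℝ), ∃ δ > (0:ℝ), ∀ u : ℝ, f u ≤ C * (1 + |u|) ^ (-4 - δ))
    (F : ℝ → ℝ≥0∞)
    (hF : ∀ c : ℝ, F c = ∫⁻ x in Ioi (0:ℝ), ENNReal.ofReal (f (-x + c * x ^ 2) * x ^ 2)) :
    (∀ c : ℝ, c ≤ 0 → F c < ⊤) ∧
      Tendsto F (nhdsWithin 0 (Iio 0)) (nhds (F 0)) := by
  obtain ⟨C, hC, δ, hδ, hdecay⟩ := hdecay
  set g : ℝ → ℝ≥0∞ := fun x => ENNReal.ofReal (C * (1 + ‖x‖) ^ (-(2 + δ)))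
  have hg_fin : ∫⁻ x in Ioi (0:ℝ), g x < ⊤ := by
    have hint : Integrable (fun x : ℝ => C * (1 + ‖x‖) ^ (-(2 + δ))) :=
      (integrable_one_add_norm (by simp; linarith)).const_mul C
    exact hint.integrableOn.setLIntegral_lt_top
  have hbound : ∀ c : ℝ, c ≤ 0 → ∀ᵐ x ∂(volume.restrict (Ioi (0:ℝ))),
      ENNReal.ofReal (f (-x + c * x ^ 2) * x ^ 2) ≤ g x := fun c hc =>
    (ae_restrict_iff' measurableSet_Ioi).2 <| ae_of_all _ fun x hx =>
      ENNReal.ofReal_le_ofReal (mul_sq_le_of_decay hC hδ hdecay hc hx)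
  refine ⟨fun c hc => ?_, ?_⟩
  · rw [hF]
    exact (lintegral_mono_ae (hbound c hc)).trans_lt hg_fin
  · rw [funext hF]
    refine tendsto_lintegral_filter_of_dominated_convergence g
      (Eventually.of_forall fun c => ?_) ?_ hg_fin.ne (ae_of_all _ fun x => ?_)
    · fun_prop
    · filter_upwards [self_mem_nhdsWithin] with c hc using hbound c (le_of_lt hc)
    · have hcont : Continuous fun c : ℝ => ENNReal.ofReal (f (-x + c * x ^ 2) * x ^ 2) :=
        ENNReal.continuous_ofReal.comp (by fun_prop)
      exact (hcont.tendsto 0).mono_left nhdsWithin_le_nhds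
end

section
/- Let f : ℝ → ℝ be continuous with f(u) > 0 for all u ∈ ℝ, and suppose there exist constants C > 0 and δ > 0 such that f(u) ≤ C·(1+|u|)^(−4−δ) for all u ∈ ℝ. Define F(c) = ∫₀^∞ f(−x + c·x²)·x² dx. Then F(c) tends to +∞ as c tends to 0 from the right. -/
open MeasureTheory Set Filter
open scoped ENNReal

/-- Lemma 1 of the paper (divergence from the right): if `f : ℝ → ℝ` is continuous,
strictly positive and decays like `(1+|u|)^(-4-δ)`, then
`F c = ∫⁻ x in (0,∞), f (-x + c x²) · x² dx` tends to `+∞` as `c → 0⁺`. -/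
theorem stmt_1 (f : ℝ → ℝ) (hf_cont : Continuous f) (hf_pos : ∀ u, 0 < f u)
    (hdecay : ∃ C > (0:ℝ), ∃ δ > (0:ℝ), ∀ u : ℝ, f u ≤ C * (1 + |u|) ^ (-4 - δ))
    (F : ℝ → ℝ≥0∞)
    (hF : ∀ c : ℝ, F c = ∫⁻ x in Ioi (0:ℝ), ENNReal.ofReal (f (-x + c * x ^ 2) * x ^ 2)) :
    Tendsto F (nhdsWithin 0 (Ioi 0)) (nhds ⊤) := by
  obtain ⟨u₀, -, hu₀⟩ := (isCompact_Icc (a := (0:ℝ)) (b := 2)).exists_isMinOn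
    ⟨0, by norm_num⟩ hf_cont.continuousOn
  set m := f u₀
  have hm : 0 < m := hf_pos u₀
  have hlim : Tendsto (fun c : ℝ => ENNReal.ofReal (m * c⁻¹ ^ 2))
      (nhdsWithin 0 (Ioi 0)) (nhds ⊤) :=
    ENNReal.tendsto_ofReal_atTop.comp
      (((tendsto_pow_atTop two_ne_zero).comp tendsto_inv_nhdsGT_zero).const_mul_atTop hm)
  refine tendsto_nhds_top_mono hlim ?_
  filter_upwards [Ioo_mem_nhdsGT (zero_lt_one' ℝ)] with c ⟨hc0, hc1⟩
  have hinv : 0 < c⁻¹ := inv_pos.mpr hc0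
  rw [hF]
  calc ENNReal.ofReal (m * c⁻¹ ^ 2)
      = ∫⁻ _ in Icc c⁻¹ (c⁻¹ + 1), ENNReal.ofReal (m * c⁻¹ ^ 2) := by simp
    _ ≤ ∫⁻ x in Icc c⁻¹ (c⁻¹ + 1), ENNReal.ofReal (f (-x + c * x ^ 2) * x ^ 2) := by
        refine setLIntegral_mono' measurableSet_Icc fun x hx => ENNReal.ofReal_le_ofReal ?_
        obtain ⟨t, rfl⟩ : ∃ t, x = c⁻¹ + t := ⟨x - c⁻¹, by ring⟩
        have ht0 : 0 ≤ t := by linarith [hx.1]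
        have ht1 : t ≤ 1 := by linarith [hx.2]
        have harg : -(c⁻¹ + t) + c * (c⁻¹ + t) ^ 2 = t + c * t ^ 2 := by
          field_simp
          ring
        have hct : c * t ^ 2 ≤ 1 := mul_le_one₀ hc1.le (sq_nonneg t) (pow_le_one₀ ht0 ht1)
        have hmem : t + c * t ^ 2 ∈ Icc (0:ℝ) 2 := ⟨by positivity, by linarith⟩
        rw [harg]
        exact mul_le_mul (hu₀ hmem) (pow_le_pow_left₀ hinv.le hx.1 2) (by positivity)
          (hf_pos _).le
    _ ≤ ∫⁻ x in Ioi (0:ℝ), ENNReal.ofReal (f (-x + c * x ^ 2) * x ^ 2) :=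
        lintegral_mono_set fun x hx => hinv.trans_le hx.1
end

section
/- For every real c with 0 < c < 1/4, the integral over (0,∞) of the function x ↦ 1_{[−1,1]}(−x + c·x²)·x² (where 1_{[−1,1]} is the indicator function of the interval [−1,1]) is at least 1/(4c²). Consequently this integral tends to +∞ as c tends to 0 from the right. -/
open MeasureTheory Set Filter
open scoped ENNReal

/-- On the unit interval ending at `1 / c`, which lies to the right of `1 / (2 * c)`, the
polynomial `-x + c * x ^ 2` takes values in `[-1, 1]`. -/
lemma neg_add_mul_sq_mem_Icc {c x : ℝ} (hc : 0 < c) (hc' : c < 1 / 4)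
    (hx : x ∈ Icc (1 / c - 1) (1 / c)) :
    1 / (2 * c) ≤ x ∧ -x + c * x ^ 2 ∈ Icc (-1 : ℝ) 1 := by
  obtain ⟨h₁, h₂⟩ := hx
  have hmul : c * (1 / c) = 1 := mul_one_div_cancel hc.ne'
  have hhalf : 1 / (2 * c) = 1 / c / 2 := by field_simp
  have hinv : 4 < 1 / c := by rw [lt_div_iff₀ hc]; linarith
  have hle : c * x ≤ 1 := hmul ▸ mul_le_mul_of_nonneg_left h₂ hc.le
  have hfac : -x + c * x ^ 2 = (x - 1 / c) + c * (x - 1 / c) ^ 2 := by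
    linear_combination (2 * x - 1 / c) * hmul
  refine ⟨by linarith, ?_, ?_⟩
  · rw [hfac]
    nlinarith [mul_nonneg hc.le (sq_nonneg (x - 1 / c))]
  · nlinarith

lemma ofReal_le_lintegral_indicator_mul_sq {c : ℝ} (hc : 0 < c) (hc' : c < 1 / 4) :
    ENNReal.ofReal (1 / (4 * c ^ 2)) ≤ ∫⁻ x in Ioi (0 : ℝ),
      ENNReal.ofReal
        (Set.indicator (Icc (-1 : ℝ) 1) (fun _ => (1 : ℝ)) (-x + c * x ^ 2) * x ^ 2) := by
  have hpos : 0 < 1 / (2 * c) := by positivity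
  calc ENNReal.ofReal (1 / (4 * c ^ 2))
      = ∫⁻ _ in Icc (1 / c - 1) (1 / c), ENNReal.ofReal (1 / (4 * c ^ 2)) := by simp
    _ ≤ ∫⁻ x in Icc (1 / c - 1) (1 / c), ENNReal.ofReal
          (Set.indicator (Icc (-1 : ℝ) 1) (fun _ => (1 : ℝ)) (-x + c * x ^ 2) * x ^ 2) := by
        refine setLIntegral_mono' measurableSet_Icc fun x hx => ENNReal.ofReal_le_ofReal ?_
        obtain ⟨hle, hmem⟩ := neg_add_mul_sq_mem_Icc hc hc' hx
        rw [indicator_of_mem hmem, one_mul]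
        calc 1 / (4 * c ^ 2) = (1 / (2 * c)) ^ 2 := by ring
          _ ≤ x ^ 2 := by gcongr
    _ ≤ _ := lintegral_mono_set fun x hx =>
        hpos.trans_le (neg_add_mul_sq_mem_Icc hc hc' hx).1

lemma tendsto_one_div_four_mul_sq_nhdsGT_zero :
    Tendsto (fun c : ℝ => 1 / (4 * c ^ 2)) (nhdsWithin 0 (Ioi 0)) atTop := by
  have h := ((tendsto_pow_atTop two_ne_zero).comp
    (tendsto_inv_nhdsGT_zero (𝕜 := ℝ))).const_mul_atTop (show (0 : ℝ) < 1 / 4 by norm_num)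
  refine h.congr fun c => ?_
  simp only [Function.comp_apply]
  ring

/-- Key estimate in the proof of Lemma 1 of the paper: for `0 < c < 1/4`,
`∫ x in (0,∞), 1_{[-1,1]}(-x + c x²) · x² dx ≥ 1/(4c²)`, and consequently this
integral tends to `+∞` as `c → 0⁺`. -/
theorem stmt_2 (G : ℝ → ℝ≥0∞)
    (hG : ∀ c : ℝ, G c = ∫⁻ x in Ioi (0:ℝ),
      ENNReal.ofReal (Set.indicator (Icc (-1:ℝ) 1) (fun _ => (1:ℝ)) (-x + c * x ^ 2) * x ^ 2)) :
    (∀ c : ℝ, 0 < c → c < 1/4 → ENNReal.ofReal (1 / (4 * c ^ 2)) ≤ G c) ∧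
      Tendsto G (nhdsWithin 0 (Ioi 0)) (nhds ⊤) := by
  have hbound : ∀ c : ℝ, 0 < c → c < 1 / 4 → ENNReal.ofReal (1 / (4 * c ^ 2)) ≤ G c :=
    fun c hc hc' => (hG c).symm ▸ ofReal_le_lintegral_indicator_mul_sq hc hc'
  refine ⟨hbound, tendsto_nhds_top_mono
    (ENNReal.tendsto_ofReal_atTop.comp tendsto_one_div_four_mul_sq_nhdsGT_zero) ?_⟩
  filter_upwards [Ioo_mem_nhdsGT (show (0 : ℝ) < 1 / 4 by norm_num)] with c hc
  exact hbound c hc.1 hc.2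
end

section
/- Let k > 0, η > 0 and ε ∈ {−1, 1}, and let u ∈ ℝ satisfy e^{−u/k} > ε. Define F(u) = η/(e^{−u/k} − ε), Δ(u) = 1 + ε·F(u)/η, and f₁(u) = −(η·k/ε)·(ln(e^{−u/k} − ε) + u/k). Then F(u) > 0, Δ(u) > 0, and the identity f₁(u) − u·F(u) = −k·( F(u)·ln(F(u)/η) − (η/ε)·Δ(u)·ln Δ(u) ) holds. -/
/-- The pointwise identity behind the paper's entropy computation: for the Bose
(`ε = 1`) / Fermi (`ε = -1`) distribution `F = η/(e^{-u/k} - ε)`, with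
`Δ = 1 + ε F/η` and `f₁ = -(η k/ε)(ln(e^{-u/k} - ε) + u/k)`, one has `F > 0`,
`Δ > 0` and `f₁ - u F = -k (F ln(F/η) - (η/ε) Δ ln Δ)`. -/
theorem stmt_6 (k η ε : ℝ) (hk : 0 < k) (hη : 0 < η) (hε : ε = -1 ∨ ε = 1)
    (u : ℝ) (hu : ε < Real.exp (-u / k))
    (F Δ f₁ : ℝ)
    (hF : F = η / (Real.exp (-u / k) - ε))
    (hΔ : Δ = 1 + ε * F / η)
    (hf₁ : f₁ = -(η * k / ε) * (Real.log (Real.exp (-u / k) - ε) + u / k)) :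
    0 < F ∧ 0 < Δ ∧
      f₁ - u * F = -k * (F * Real.log (F / η) - η / ε * Δ * Real.log Δ) := by
  have hε0 : ε ≠ 0 := by rcases hε with rfl | rfl <;> norm_num
  set E := Real.exp (-u / k) with hE
  have hEpos : 0 < E := Real.exp_pos _
  have hD : 0 < E - ε := sub_pos.mpr hu
  have hΔ' : Δ = E / (E - ε) := by
    rw [hΔ, hF]
    field_simp
    ring
  have hlogF : Real.log (F / η) = -Real.log (E - ε) := by
    rw [← Real.log_inv, hF]
    congr 1
    field_simp
  have hlogΔ : Real.log Δ = -u / k - Real.log (E - ε) := by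
    rw [hΔ', Real.log_div hEpos.ne' hD.ne', hE, Real.log_exp]
  refine ⟨hF ▸ div_pos hη hD, hΔ' ▸ div_pos hEpos hD, ?_⟩
  rw [hlogF, hlogΔ, hΔ', hf₁, hF]
  generalize Real.log (E - ε) = L
  field_simp
  ring
end

section
/- Fix m > 0 and for q ∈ ℝ³ set p(q) = (√(m² + |q|²), q₁, q₂, q₃) ∈ ℝ⁴. Let δζ ∈ ℝ, let δv ∈ ℝ⁴, and let δZ be a symmetric real 4×4 matrix with −δZ₀₀ + δZ₁₁ + δZ₂₂ + δZ₃₃ = 0. If δζ + ⟨δv, p(q)⟩ + δZ(p(q), p(q)) = 0 for every q ∈ ℝ³, then δζ = 0, δv = 0 and δZ = 0. Here ⟨u,v⟩ = −u₀v₀ + u₁v₁ + u₂v₂ + u₃v₃ and δZ(u,u) = Σ_{a,b} δZ_{ab}·u_a·u_b. -/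
/-- The Minkowski inner product on `ℝ⁴`. -/
def mink (u v : Fin 4 → ℝ) : ℝ :=
  -(u 0 * v 0) + u 1 * v 1 + u 2 * v 2 + u 3 * v 3

/-- The quadratic form `Z(u,u) = Σ_{a,b} Z_{ab} u_a u_b` of a `4×4` matrix. -/
def quad (Z : Fin 4 → Fin 4 → ℝ) (u : Fin 4 → ℝ) : ℝ :=
  ∑ a : Fin 4, ∑ b : Fin 4, Z a b * u a * u b

/-- The future mass shell of mass `m`, parametrized by `q ∈ ℝ³`:
`p(q) = (√(m² + |q|²), q)`. -/
noncomputable def pshell (m : ℝ) (q : Fin 3 → ℝ) : Fin 4 → ℝ :=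
  ![Real.sqrt (m ^ 2 + (q 0 ^ 2 + q 1 ^ 2 + q 2 ^ 2)), q 0, q 1, q 2]

/-- A quadratic polynomial in `(E, x)` vanishing on the upper branch of the hyperbola
`E² = m² + x²` is a multiple of `E² - x² - m²`. -/
theorem coeff_eq_of_vanish_on_hyperbola {m : ℝ} (hm : 0 < m) {c a b A B C : ℝ}
    (h : ∀ E x : ℝ, 0 ≤ E → E ^ 2 = m ^ 2 + x ^ 2 →
      c + a * E + b * x + A * E ^ 2 + 2 * B * (E * x) + C * x ^ 2 = 0) :
    c = C * m ^ 2 ∧ a = 0 ∧ b = 0 ∧ A + C = 0 ∧ B = 0 := by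
  have h₀ := h m 0 hm.le (by ring)
  have h₁ := h (5 / 4 * m) (3 / 4 * m) (by positivity) (by ring)
  have h₂ := h (5 / 4 * m) (-(3 / 4 * m)) (by positivity) (by ring)
  have h₃ := h (5 / 3 * m) (4 / 3 * m) (by positivity) (by ring)
  have h₄ := h (5 / 3 * m) (-(4 / 3 * m)) (by positivity) (by ring)
  ring_nf at h₀ h₁ h₂ h₃ h₄
  have ha : a * m = 0 := by linarith
  have hb : b * m = 0 := by linarith
  have hAC : (A + C) * m ^ 2 = 0 := by linarith
  have hB : B * m ^ 2 = 0 := by linarith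
  have hc : c = C * m ^ 2 := by linarith
  have hm₀ := hm.ne'
  have hm₂ := pow_ne_zero 2 hm₀
  exact ⟨hc, (mul_eq_zero.mp ha).resolve_right hm₀, (mul_eq_zero.mp hb).resolve_right hm₀,
    (mul_eq_zero.mp hAC).resolve_right hm₂, (mul_eq_zero.mp hB).resolve_right hm₂⟩

/-- Injectivity lemma: a perturbation `(δζ, δv, δZ)`, with `δZ` symmetric and
Minkowski trace-free, is determined by the values of
`δζ + ⟨δv, p⟩ + δZ(p, p)` on the future mass shell. -/
theorem stmt_9 (m : ℝ) (hm : 0 < m)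
    (δζ : ℝ) (δv : Fin 4 → ℝ) (δZ : Fin 4 → Fin 4 → ℝ)
    (hsymm : ∀ a b, δZ a b = δZ b a)
    (htrace : -δZ 0 0 + δZ 1 1 + δZ 2 2 + δZ 3 3 = 0)
    (hvanish : ∀ q : Fin 3 → ℝ,
      δζ + mink δv (pshell m q) + quad δZ (pshell m q) = 0) :
    δζ = 0 ∧ δv = 0 ∧ δZ = 0 := by
  have key : ∀ E x y z : ℝ, 0 ≤ E → E ^ 2 = m ^ 2 + (x ^ 2 + y ^ 2 + z ^ 2) →
      δζ + mink δv ![E, x, y, z] + quad δZ ![E, x, y, z] = 0 := by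
    intro E x y z hE h
    have := hvanish ![x, y, z]
    simpa [pshell, ← h, Real.sqrt_sq hE] using this
  simp only [mink, quad, Fin.sum_univ_four, Matrix.cons_val] at key
  have s10 := hsymm 1 0
  have s20 := hsymm 2 0
  have s30 := hsymm 3 0
  have s21 := hsymm 2 1
  have s31 := hsymm 3 1
  have s32 := hsymm 3 2
  rw [s10, s20, s30, s21, s31, s32] at key
  obtain ⟨hc, ha, hv1, h11, h01⟩ := coeff_eq_of_vanish_on_hyperbola hm
    (c := δζ) (a := -δv 0) (b := δv 1) (A := δZ 0 0) (B := δZ 0 1) (C := δZ 1 1)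
    fun E x hE h => by linear_combination key E x 0 0 hE (by linear_combination h)
  obtain ⟨-, -, hv2, h22, h02⟩ := coeff_eq_of_vanish_on_hyperbola hm
    (c := δζ) (a := -δv 0) (b := δv 2) (A := δZ 0 0) (B := δZ 0 2) (C := δZ 2 2)
    fun E x hE h => by linear_combination key E 0 x 0 hE (by linear_combination h)
  obtain ⟨-, -, hv3, h33, h03⟩ := coeff_eq_of_vanish_on_hyperbola hm
    (c := δζ) (a := -δv 0) (b := δv 3) (A := δZ 0 0) (B := δZ 0 3) (C := δZ 3 3)
    fun E x hE h => by linear_combination key E 0 0 x hE (by linear_combination h)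
  have hv0 : δv 0 = 0 := by linarith
  have z00 : δZ 0 0 = 0 := by linarith
  have z11 : δZ 1 1 = 0 := by linarith
  have z22 : δZ 2 2 = 0 := by linarith
  have z33 : δZ 3 3 = 0 := by linarith
  have hζ : δζ = 0 := by rw [hc, z11, zero_mul]
  have hm₀ := hm.ne'
  have h12 := key (3 * m) (2 * m) (2 * m) 0 (by positivity) (by ring)
  have h13 := key (3 * m) (2 * m) 0 (2 * m) (by positivity) (by ring)
  have h23 := key (3 * m) 0 (2 * m) (2 * m) (by positivity) (by ring)
  simp only [hζ, hv0, hv1, hv2, hv3, z00, z11, z22, z33, h01, h02, h03] at h12 h13 h23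
  have z12 : δZ 1 2 = 0 := (mul_eq_zero.mp (by linarith : δZ 1 2 * m ^ 2 = 0)).resolve_right
    (pow_ne_zero 2 hm₀)
  have z13 : δZ 1 3 = 0 := (mul_eq_zero.mp (by linarith : δZ 1 3 * m ^ 2 = 0)).resolve_right
    (pow_ne_zero 2 hm₀)
  have z23 : δZ 2 3 = 0 := (mul_eq_zero.mp (by linarith : δZ 2 3 * m ^ 2 = 0)).resolve_right
    (pow_ne_zero 2 hm₀)
  refine ⟨hζ, ?_, ?_⟩
  · ext a
    fin_cases a <;> simp [*]
  · ext a b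
    fin_cases a <;> fin_cases b <;> simp [*]
end

section
/- Fix m > 0 and for q ∈ ℝ³ set p(q) = (√(m² + |q|²), q₁, q₂, q₃) ∈ ℝ⁴, with Minkowski inner product ⟨u,v⟩ = −u₀v₀ + u₁v₁ + u₂v₂ + u₃v₃ and mass-shell measure dω(q) = dq/√(m² + |q|²). Let f : ℝ → ℝ be three times differentiable on (−∞, 0) with f‴(u) > 0 for all u < 0. Let ζ < 0, let ξ and t be future-directed timelike vectors, and let (δζ, δv) ∈ ℝ × ℝ⁴ with (δζ, δv) ≠ (0, 0). Assume the function q ↦ ⟨t, p(q)⟩ · f‴(ζ + ⟨ξ, p(q)⟩) · (δζ + ⟨δv, p(q)⟩)² is integrable with respect to dω. Then ∫_{ℝ³} ⟨t, p(q)⟩ · f‴(ζ + ⟨ξ, p(q)⟩) · (δζ + ⟨δv, p(q)⟩)² dω(q) < 0. -/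
open MeasureTheory

/-- A future-directed timelike vector has negative Minkowski product with every point of the
future mass shell. -/
theorem mink_pshell_neg {m : ℝ} (hm : 0 < m) {t : Fin 4 → ℝ} (ht0 : 0 < t 0)
    (htt : mink t t < 0) (q : Fin 3 → ℝ) : mink t (pshell m q) < 0 := by
  have hE : 0 < Real.sqrt (m ^ 2 + (q 0 ^ 2 + q 1 ^ 2 + q 2 ^ 2)) := by positivity
  have hE2 := Real.sq_sqrt (show 0 ≤ m ^ 2 + (q 0 ^ 2 + q 1 ^ 2 + q 2 ^ 2) by positivity)
  simp only [mink, pshell, Matrix.cons_val] at htt ⊢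
  set E := Real.sqrt (m ^ 2 + (q 0 ^ 2 + q 1 ^ 2 + q 2 ^ 2))
  have hcs : (t 1 * q 0 + t 2 * q 1 + t 3 * q 2) ^ 2 ≤
      (t 1 ^ 2 + t 2 ^ 2 + t 3 ^ 2) * (q 0 ^ 2 + q 1 ^ 2 + q 2 ^ 2) := by
    nlinarith [sq_nonneg (t 1 * q 1 - t 2 * q 0), sq_nonneg (t 1 * q 2 - t 3 * q 0),
      sq_nonneg (t 2 * q 2 - t 3 * q 1)]
  have hle : (t 1 ^ 2 + t 2 ^ 2 + t 3 ^ 2) * (q 0 ^ 2 + q 1 ^ 2 + q 2 ^ 2) ≤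
      t 0 ^ 2 * (q 0 ^ 2 + q 1 ^ 2 + q 2 ^ 2) := by
    gcongr
    linarith
  have hlt : t 0 ^ 2 * (q 0 ^ 2 + q 1 ^ 2 + q 2 ^ 2) < (t 0 * E) ^ 2 := by
    rw [mul_pow, hE2]
    exact mul_lt_mul_of_pos_left (lt_add_of_pos_left _ (pow_pos hm 2)) (pow_pos ht0 2)
  have := lt_of_pow_lt_pow_left₀ 2 (by positivity) (hcs.trans_lt (hle.trans_lt hlt))
  linarith

theorem continuous_mink_pshell (m : ℝ) (v : Fin 4 → ℝ) :
    Continuous fun q => mink v (pshell m q) := by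
  simp only [mink, pshell, Matrix.cons_val]
  fun_prop

/-- An affine function on `ℝ⁴` that vanishes on the future mass shell is zero. -/
theorem eq_zero_of_forall_add_mink_pshell_eq_zero {m : ℝ} (hm : 0 < m) {a : ℝ}
    {v : Fin 4 → ℝ} (h : ∀ q, a + mink v (pshell m q) = 0) : a = 0 ∧ v = 0 := by
  have h0 := h 0
  have h1 := h ![1, 0, 0]
  have h1' := h ![-1, 0, 0]
  have h2 := h ![0, 1, 0]
  have h2' := h ![0, -1, 0]
  have h3 := h ![0, 0, 1]
  have h3' := h ![0, 0, -1]
  simp only [mink, pshell, Matrix.cons_val, Pi.zero_apply] at h0 h1 h1' h2 h2' h3 h3'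
  norm_num [hm.le] at h0 h1 h1' h2 h2' h3 h3'
  have hlt : m < Real.sqrt (m ^ 2 + 1) := Real.lt_sqrt_of_sq_lt (by linarith)
  have hv0 : v 0 = 0 := by
    have : v 0 * (Real.sqrt (m ^ 2 + 1) - m) = 0 := by linarith
    exact (mul_eq_zero.mp this).resolve_right (sub_ne_zero.mpr hlt.ne')
  refine ⟨by simpa [hv0] using h0, ?_⟩
  ext i
  fin_cases i <;> simp only [Fin.reduceFinMk, Fin.zero_eta, Fin.mk_one, Pi.zero_apply] <;> linarith

/-- Manifest causality of statistical perfect fluid theories (Theorem 1 of the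
paper, equilibrium case): if `f‴ > 0` on `(-∞, 0)`, then for every nonzero
perturbation `(δζ, δv)` and every future-directed timelike `t`, the mass-shell
integral `∫ ⟨t, p⟩ f‴(ζ + ⟨ξ, p⟩) (δζ + ⟨δv, p⟩)² dω` is strictly negative. -/
theorem stmt_10 (m : ℝ) (hm : 0 < m)
    (f f1 f2 f3 : ℝ → ℝ)
    (hd1 : ∀ u < (0:ℝ), HasDerivAt f (f1 u) u)
    (hd2 : ∀ u < (0:ℝ), HasDerivAt f1 (f2 u) u)
    (hd3 : ∀ u < (0:ℝ), HasDerivAt f2 (f3 u) u)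
    (hpos : ∀ u < (0:ℝ), 0 < f3 u)
    (ζ : ℝ) (hζ : ζ < 0)
    (ξ t : Fin 4 → ℝ)
    (hξ0 : 0 < ξ 0) (hξξ : mink ξ ξ < 0)
    (ht0 : 0 < t 0) (htt : mink t t < 0)
    (δζ : ℝ) (δv : Fin 4 → ℝ) (hne : ¬(δζ = 0 ∧ δv = 0))
    (hint : Integrable (fun q : Fin 3 → ℝ =>
      mink t (pshell m q) * f3 (ζ + mink ξ (pshell m q)) *
        (δζ + mink δv (pshell m q)) ^ 2 /
          Real.sqrt (m ^ 2 + (q 0 ^ 2 + q 1 ^ 2 + q 2 ^ 2)))) :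
    (∫ q : Fin 3 → ℝ,
      mink t (pshell m q) * f3 (ζ + mink ξ (pshell m q)) *
        (δζ + mink δv (pshell m q)) ^ 2 /
          Real.sqrt (m ^ 2 + (q 0 ^ 2 + q 1 ^ 2 + q 2 ^ 2))) < 0 := by
  have hE (q : Fin 3 → ℝ) : 0 < Real.sqrt (m ^ 2 + (q 0 ^ 2 + q 1 ^ 2 + q 2 ^ 2)) := by
    positivity
  have hf3 (q : Fin 3 → ℝ) : 0 < f3 (ζ + mink ξ (pshell m q)) :=
    hpos _ (by linarith [mink_pshell_neg hm hξ0 hξξ q])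
  have ht (q : Fin 3 → ℝ) := mink_pshell_neg hm ht0 htt q
  rw [← neg_pos, ← integral_neg]
  refine (integral_pos_iff_support_of_nonneg ?_ hint.neg).mpr ?_
  rotate_left
  · have hopen : IsOpen {q : Fin 3 → ℝ | δζ + mink δv (pshell m q) ≠ 0} :=
      isOpen_ne_fun (continuous_const.add (continuous_mink_pshell m δv)) continuous_const
    have hnonempty : {q : Fin 3 → ℝ | δζ + mink δv (pshell m q) ≠ 0}.Nonempty := by
      by_contra! hempty
      exact hne (eq_zero_of_forall_add_mink_pshell_eq_zero hm
        fun q => not_not.mp (Set.eq_empty_iff_forall_notMem.mp hempty q))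
    refine (hopen.measure_pos volume hnonempty).trans_le (measure_mono fun q hq => ?_)
    exact neg_ne_zero.mpr (div_ne_zero (mul_ne_zero (mul_ne_zero (ht q).ne (hf3 q).ne')
      (pow_ne_zero 2 hq)) (hE q).ne')
  · intro q
    exact neg_nonneg.mpr (div_nonpos_of_nonpos_of_nonneg (mul_nonpos_of_nonpos_of_nonneg
      (mul_nonpos_of_nonpos_of_nonneg (ht q).le (hf3 q).le) (sq_nonneg _)) (hE q).le)
end

section
/- Fix m > 0 and for q ∈ ℝ³ set p(q) = (√(m² + |q|²), q₁, q₂, q₃) ∈ ℝ⁴, with Minkowski inner product ⟨u,v⟩ = −u₀v₀ + u₁v₁ + u₂v₂ + u₃v₃ and mass-shell measure dω(q) = dq/√(m² + |q|²). Let f : ℝ → ℝ be three times differentiable on (−∞, 0) with f‴(u) > 0 for all u < 0. Let ζ < 0, let ξ and t be future-directed timelike vectors, and let Z, δZ be symmetric real 4×4 matrices with −Z₀₀ + Z₁₁ + Z₂₂ + Z₃₃ = 0 and −δZ₀₀ + δZ₁₁ + δZ₂₂ + δZ₃₃ = 0. Assume ζ + ⟨ξ, p(q)⟩ + Z(p(q),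 p(q)) < 0 for all q ∈ ℝ³, and let (δζ, δv, δZ) ∈ ℝ × ℝ⁴ × (symmetric matrices) be not all zero. Assume the function q ↦ ⟨t, p(q)⟩ · f‴(ζ + ⟨ξ, p(q)⟩ + Z(p(q), p(q))) · (δζ + ⟨δv, p(q)⟩ + δZ(p(q), p(q)))² is integrable with respect to dω. Then its integral over ℝ³ is strictly negative. -/
open MeasureTheory

theorem continuous_pshell (m : ℝ) : Continuous (pshell m) := by
  refine continuous_pi fun i => ?_
  fin_cases i <;> simp [pshell] <;> fun_prop

theorem continuous_mink_right (v : Fin 4 → ℝ) : Continuous (mink v) := by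
  unfold mink
  fun_prop

theorem continuous_quad (Z : Fin 4 → Fin 4 → ℝ) : Continuous (quad Z) := by
  unfold quad
  fun_prop

/-- If the even quadratic polynomial in the energy and the odd part both vanish along an axis of
momentum space, then their coefficients vanish. -/
theorem coeffs_eq_zero_of_axis {m a b c d e : ℝ} (hm : 0 < m)
    (h : ∀ s E : ℝ, 0 ≤ E → E ^ 2 = m ^ 2 + s ^ 2 →
      a + b * s ^ 2 + c * E + d * s + e * (E * s) = 0) :
    a = 0 ∧ b = 0 ∧ c = 0 ∧ d = 0 ∧ e = 0 := by
  have h0 := h 0 m hm.le (by ring)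
  have h1 := h (4 / 3 * m) (5 / 3 * m) (by positivity) (by ring)
  have h2 := h (-(4 / 3 * m)) (5 / 3 * m) (by positivity) (by ring)
  have h3 := h (12 / 5 * m) (13 / 5 * m) (by positivity) (by ring)
  have h4 := h (-(12 / 5 * m)) (13 / 5 * m) (by positivity) (by ring)
  have he : e * m ^ 2 = 0 := by linarith
  have hd : d * m = 0 := by linarith
  have hb : b * m ^ 2 = 0 := by linarith
  have hc : c * m = 0 := by linarith
  have he' : e = 0 := by simpa [hm.ne'] using he
  have hd' : d = 0 := by simpa [hm.ne'] using hd
  have hb' : b = 0 := by simpa [hm.ne'] using hb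
  have hc' : c = 0 := by simpa [hm.ne'] using hc
  subst he' hd' hb' hc'
  exact ⟨by linarith, rfl, rfl, rfl, rfl⟩

/-- The functions `1`, `p_a` and the trace-free quadratics `p_a p_b` are linearly independent on
the mass shell. -/
theorem eq_zero_of_vanish_on_pshell {m : ℝ} (hm : 0 < m) {c : ℝ} {v : Fin 4 → ℝ}
    {Z : Fin 4 → Fin 4 → ℝ} (hsymm : ∀ a b, Z a b = Z b a)
    (htrace : -Z 0 0 + Z 1 1 + Z 2 2 + Z 3 3 = 0)
    (h : ∀ q, c + mink v (pshell m q) + quad Z (pshell m q) = 0) :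
    c = 0 ∧ v = 0 ∧ Z = 0 := by
  have key : ∀ x y z E : ℝ, 0 ≤ E → E ^ 2 = m ^ 2 + (x ^ 2 + y ^ 2 + z ^ 2) →
      c + (-(v 0 * E) + v 1 * x + v 2 * y + v 3 * z) +
        (Z 0 0 * E ^ 2 + Z 1 1 * x ^ 2 + Z 2 2 * y ^ 2 + Z 3 3 * z ^ 2 +
          2 * (Z 0 1 * (E * x) + Z 0 2 * (E * y) + Z 0 3 * (E * z) +
            Z 1 2 * (x * y) + Z 1 3 * (x * z) + Z 2 3 * (y * z))) = 0 := by
    intro x y z E hE hE2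
    have hq := h ![x, y, z]
    have hs : Real.sqrt (m ^ 2 + (x ^ 2 + y ^ 2 + z ^ 2)) = E := by
      rw [← hE2, Real.sqrt_sq hE]
    simp only [mink, quad, pshell, Fin.sum_univ_four, Matrix.cons_val, hs] at hq
    rw [hsymm 1 0, hsymm 2 0, hsymm 3 0, hsymm 2 1, hsymm 3 1, hsymm 3 2] at hq
    linear_combination hq
  obtain ⟨ha, hb1, hv0, hv1, h01⟩ := coeffs_eq_zero_of_axis (a := c + Z 0 0 * m ^ 2)
    (b := Z 0 0 + Z 1 1) (c := -v 0) (d := v 1) (e := 2 * Z 0 1) hm fun s E hE hE2 => by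
      linear_combination key s 0 0 E hE (by linarith) - Z 0 0 * hE2
  obtain ⟨-, hb2, -, hv2, h02⟩ := coeffs_eq_zero_of_axis (a := c + Z 0 0 * m ^ 2)
    (b := Z 0 0 + Z 2 2) (c := -v 0) (d := v 2) (e := 2 * Z 0 2) hm fun s E hE hE2 => by
      linear_combination key 0 s 0 E hE (by linarith) - Z 0 0 * hE2
  obtain ⟨-, hb3, -, hv3, h03⟩ := coeffs_eq_zero_of_axis (a := c + Z 0 0 * m ^ 2)
    (b := Z 0 0 + Z 3 3) (c := -v 0) (d := v 3) (e := 2 * Z 0 3) hm fun s E hE hE2 => by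
      linear_combination key 0 0 s E hE (by linarith) - Z 0 0 * hE2
  replace hv0 : v 0 = 0 := by linarith
  have h00 : Z 0 0 = 0 := by linarith
  have h11 : Z 1 1 = 0 := by linarith
  have h22 : Z 2 2 = 0 := by linarith
  have h33 : Z 3 3 = 0 := by linarith
  replace h01 : Z 0 1 = 0 := by linarith
  replace h02 : Z 0 2 = 0 := by linarith
  replace h03 : Z 0 3 = 0 := by linarith
  have hc : c = 0 := by simpa [h00] using ha
  have off : ∀ x y z : ℝ, Z 1 2 * (x * y) + Z 1 3 * (x * z) + Z 2 3 * (y * z) = 0 := by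
    intro x y z
    have := key x y z _ (Real.sqrt_nonneg _) (Real.sq_sqrt (by positivity))
    simpa [hc, hv0, hv1, hv2, hv3, h00, h11, h22, h33, h01, h02, h03] using this
  have h12 : Z 1 2 = 0 := by simpa using off 1 1 0
  have h13 : Z 1 3 = 0 := by simpa using off 1 0 1
  have h23 : Z 2 3 = 0 := by simpa using off 0 1 1
  refine ⟨hc, ?_, ?_⟩
  · ext i
    fin_cases i <;> assumption
  · ext i j
    fin_cases i <;> fin_cases j <;> first | assumption | (rw [hsymm]; assumption)

/-- Theorem 1 of the paper: the natural dissipative extension of a manifestly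
causal statistical theory (`f‴ > 0` on `(-∞, 0)`) is causal on the statistical
domain: for states with `ζ + ⟨ξ, p⟩ + Z(p,p) < 0` on the whole future mass shell
and every nonzero perturbation `(δζ, δv, δZ)`, the causality integral
`∫ ⟨t, p⟩ f‴(ζ + ⟨ξ, p⟩ + Z(p,p)) (δζ + ⟨δv, p⟩ + δZ(p,p))² dω` is strictly
negative. -/
theorem stmt_11 (m : ℝ) (hm : 0 < m)
    (f f1 f2 f3 : ℝ → ℝ)
    (hd1 : ∀ u < (0:ℝ), HasDerivAt f (f1 u) u)
    (hd2 : ∀ u < (0:ℝ), HasDerivAt f1 (f2 u) u)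
    (hd3 : ∀ u < (0:ℝ), HasDerivAt f2 (f3 u) u)
    (hpos : ∀ u < (0:ℝ), 0 < f3 u)
    (ζ : ℝ) (hζ : ζ < 0)
    (ξ t : Fin 4 → ℝ)
    (hξ0 : 0 < ξ 0) (hξξ : mink ξ ξ < 0)
    (ht0 : 0 < t 0) (htt : mink t t < 0)
    (Z δZ : Fin 4 → Fin 4 → ℝ)
    (hZsymm : ∀ a b, Z a b = Z b a)
    (hZtrace : -Z 0 0 + Z 1 1 + Z 2 2 + Z 3 3 = 0)
    (hδZsymm : ∀ a b, δZ a b = δZ b a)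
    (hδZtrace : -δZ 0 0 + δZ 1 1 + δZ 2 2 + δZ 3 3 = 0)
    (hneg : ∀ q : Fin 3 → ℝ, ζ + mink ξ (pshell m q) + quad Z (pshell m q) < 0)
    (δζ : ℝ) (δv : Fin 4 → ℝ) (hne : ¬(δζ = 0 ∧ δv = 0 ∧ δZ = 0))
    (hint : Integrable (fun q : Fin 3 → ℝ =>
      mink t (pshell m q) * f3 (ζ + mink ξ (pshell m q) + quad Z (pshell m q)) *
        (δζ + mink δv (pshell m q) + quad δZ (pshell m q)) ^ 2 /
          Real.sqrt (m ^ 2 + (q 0 ^ 2 + q 1 ^ 2 + q 2 ^ 2)))) :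
    (∫ q : Fin 3 → ℝ,
      mink t (pshell m q) * f3 (ζ + mink ξ (pshell m q) + quad Z (pshell m q)) *
        (δζ + mink δv (pshell m q) + quad δZ (pshell m q)) ^ 2 /
          Real.sqrt (m ^ 2 + (q 0 ^ 2 + q 1 ^ 2 + q 2 ^ 2))) < 0 := by
  set g : (Fin 3 → ℝ) → ℝ := fun q => δζ + mink δv (pshell m q) + quad δZ (pshell m q) with hg
  have hE : ∀ q : Fin 3 → ℝ, 0 < Real.sqrt (m ^ 2 + (q 0 ^ 2 + q 1 ^ 2 + q 2 ^ 2)) :=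
    fun q => Real.sqrt_pos.mpr (by positivity)
  have hw : ∀ q : Fin 3 → ℝ,
      mink t (pshell m q) * f3 (ζ + mink ξ (pshell m q) + quad Z (pshell m q)) < 0 :=
    fun q => mul_neg_of_neg_of_pos (mink_pshell_neg hm ht0 htt q) (hpos _ (hneg q))
  have hnonpos : ∀ q : Fin 3 → ℝ,
      mink t (pshell m q) * f3 (ζ + mink ξ (pshell m q) + quad Z (pshell m q)) * g q ^ 2 /
        Real.sqrt (m ^ 2 + (q 0 ^ 2 + q 1 ^ 2 + q 2 ^ 2)) ≤ 0 :=
    fun q => div_nonpos_of_nonpos_of_nonneg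
      (mul_nonpos_of_nonpos_of_nonneg (hw q).le (sq_nonneg _)) (hE q).le
  refine lt_of_le_of_ne (integral_nonpos hnonpos) fun h0 => hne ?_
  have hae := (integral_eq_zero_iff_of_nonneg (fun q => neg_nonneg.mpr (hnonpos q)) hint.neg).mp
    (by rw [integral_neg, neg_eq_zero]; exact h0)
  have hg_ae : g =ᵐ[volume] 0 := by
    filter_upwards [hae] with q hq
    simpa [(hw q).ne, (mul_ne_zero_iff.mp (hw q).ne).1, (mul_ne_zero_iff.mp (hw q).ne).2,
      (hE q).ne'] using hq
  have hcont : Continuous g :=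
    (continuous_const.add ((continuous_mink_right δv).comp (continuous_pshell m))).add
      ((continuous_quad δZ).comp (continuous_pshell m))
  exact eq_zero_of_vanish_on_pshell hm hδZsymm hδZtrace
    (congrFun (hcont.ae_eq_iff_eq volume continuous_const |>.mp hg_ae))
end

section
/- Fix m > 0 and for q ∈ ℝ³ set p(q) = (√(m² + |q|²), q₁, q₂, q₃) ∈ ℝ⁴, with Minkowski inner product ⟨u,v⟩ = −u₀v₀ + u₁v₁ + u₂v₂ + u₃v₃. Let k > 0, ζ ∈ ℝ, and let ξ be a future-directed timelike vector (ξ₀ > 0, ⟨ξ,ξ⟩ < 0). Then the function q ↦ exp((ζ + ⟨ξ, p(q)⟩)/k) / √(m² + |q|²) is Lebesgue integrable on ℝ³. -/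
open MeasureTheory

/-- The exponential `x ↦ e^{-b|x|}` is integrable on the real line for `b > 0`. -/
theorem integrable_exp_neg_mul_abs {b : ℝ} (hb : 0 < b) :
    Integrable (fun x : ℝ => Real.exp (-b * |x|)) := by
  rw [← integrableOn_univ, ← Set.Iic_union_Ioi (a := (0 : ℝ)), integrableOn_union]
  constructor
  · refine (integrableOn_exp_mul_Iic hb 0).congr_fun (fun x hx => ?_) measurableSet_Iic
    simp only [abs_of_nonpos (Set.mem_Iic.mp hx), neg_mul_neg]
  · refine (integrableOn_exp_mul_Ioi (neg_neg_of_pos hb) 0).congr_fun (fun x hx => ?_)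
      measurableSet_Ioi
    simp only [abs_of_pos (Set.mem_Ioi.mp hx)]

/-- A future-directed timelike vector pairs with the mass shell at most like a negative multiple
of the `ℓ¹` norm of the momentum. -/
theorem exists_mink_pshell_le (m : ℝ) {ξ : Fin 4 → ℝ} (hξ0 : 0 < ξ 0) (hξξ : mink ξ ξ < 0) :
    ∃ c > 0, ∀ q : Fin 3 → ℝ, mink ξ (pshell m q) ≤ -c * ∑ i, |q i| := by
  set a := Real.sqrt (ξ 1 ^ 2 + ξ 2 ^ 2 + ξ 3 ^ 2) with ha
  have ha0 : 0 ≤ a := Real.sqrt_nonneg _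
  have ha2 : a ^ 2 = ξ 1 ^ 2 + ξ 2 ^ 2 + ξ 3 ^ 2 := Real.sq_sqrt (by positivity)
  have hlt : a < ξ 0 := by
    rw [ha, Real.sqrt_lt' hξ0]
    simp only [mink] at hξξ
    linarith
  refine ⟨(ξ 0 - a) / 3, by linarith, fun q => ?_⟩
  set S := Real.sqrt (m ^ 2 + (q 0 ^ 2 + q 1 ^ 2 + q 2 ^ 2)) with hS
  have hS0 : 0 ≤ S := Real.sqrt_nonneg _
  have hS2 : S ^ 2 = m ^ 2 + (q 0 ^ 2 + q 1 ^ 2 + q 2 ^ 2) := Real.sq_sqrt (by positivity)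
  have hq : ∀ i, |q i| ≤ S := by
    intro i
    refine Real.abs_le_sqrt ?_
    fin_cases i <;> simp only [Fin.zero_eta, Fin.mk_one, Fin.reduceFinMk] <;>
      nlinarith [sq_nonneg m, sq_nonneg (q 0), sq_nonneg (q 1), sq_nonneg (q 2)]
  have hsum : ∑ i, |q i| ≤ 3 * S := by
    rw [Fin.sum_univ_three]
    linarith [hq 0, hq 1, hq 2]
  have hcs : ξ 1 * q 0 + ξ 2 * q 1 + ξ 3 * q 2 ≤ a * S := by
    refine abs_le_of_sq_le_sq' ?_ (by positivity) |>.2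
    rw [mul_pow, ha2, hS2]
    nlinarith [sq_nonneg (ξ 1 * q 1 - ξ 2 * q 0), sq_nonneg (ξ 1 * q 2 - ξ 3 * q 0),
      sq_nonneg (ξ 2 * q 2 - ξ 3 * q 1), sq_nonneg (ξ 1 * m), sq_nonneg (ξ 2 * m),
      sq_nonneg (ξ 3 * m)]
  have hmink : mink ξ (pshell m q) = -(ξ 0 * S) + (ξ 1 * q 0 + ξ 2 * q 1 + ξ 3 * q 2) := by
    simp [mink, pshell, ← hS]
    ring
  rw [hmink]
  nlinarith [mul_le_mul_of_nonneg_left hsum (sub_nonneg.mpr hlt.le)]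

/-- Integrability of the Boltzmann distribution over the future mass shell:
for `k > 0`, `ζ ∈ ℝ` and `ξ` future-directed timelike, the function
`q ↦ e^{(ζ + ⟨ξ, p(q)⟩)/k} / √(m² + |q|²)` is Lebesgue integrable on `ℝ³`. -/
theorem stmt_15 (m : ℝ) (hm : 0 < m) (k : ℝ) (hk : 0 < k) (ζ : ℝ)
    (ξ : Fin 4 → ℝ) (hξ0 : 0 < ξ 0) (hξξ : mink ξ ξ < 0) :
    Integrable (fun q : Fin 3 → ℝ =>
      Real.exp ((ζ + mink ξ (pshell m q)) / k) /
        Real.sqrt (m ^ 2 + (q 0 ^ 2 + q 1 ^ 2 + q 2 ^ 2))) := by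
  obtain ⟨c, hc, hle⟩ := exists_mink_pshell_le m hξ0 hξξ
  have hprod : Integrable (fun q : Fin 3 → ℝ => ∏ i, Real.exp (-(c / k) * |q i|)) :=
    Integrable.fintype_prod (f := fun _ x => Real.exp (-(c / k) * |x|))
      fun _ => integrable_exp_neg_mul_abs (div_pos hc hk)
  refine (hprod.const_mul (Real.exp (ζ / k) / m)).mono' ?_ (.of_forall fun q => ?_)
  · refine Measurable.aestronglyMeasurable ?_
    simp only [mink, pshell, Matrix.cons_val]
    fun_prop
  · have hm' : m ≤ Real.sqrt (m ^ 2 + (q 0 ^ 2 + q 1 ^ 2 + q 2 ^ 2)) :=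
      Real.le_sqrt_of_sq_le (le_add_of_nonneg_right (by positivity))
    rw [Real.norm_of_nonneg (by positivity), div_mul_eq_mul_div, ← Real.exp_sum, ← Real.exp_add,
      ← Finset.mul_sum]
    have hexp : (ζ + mink ξ (pshell m q)) / k ≤ ζ / k + -(c / k) * ∑ i, |q i| := by
      calc (ζ + mink ξ (pshell m q)) / k ≤ (ζ + -c * ∑ i, |q i|) / k := by gcongr; exact hle q
        _ = _ := by ring
    gcongr
end
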